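/- Let t ∈ ℚ[X] be any polynomial and let m = ℳ(t). Then in the field of rational functions ℚ(y) (with y the generator, evaluations taken via the polynomial evaluation algebra map into ℚ(y)), one has m(y²/(y−1)) · (y−2)/(y−1) = t(y) − (1/(y−1)) · t(y/(y−1)). -/

import Mathlib

open Polynomial

/-- The formula for `ℳ(Xⁿ) = ∑_{k=0}^{⌊n/2⌋} (−1)^k · C(n−k, k) · X^{n−k}`. -/
noncomputable def Mform (n : ℕ) : Polynomial ℚ :=
  ∑ k ∈ Finset.range (n / 2 + 1),
    Polynomial.C ((-1 : ℚ) ^ k * (Nat.choose (n - k) k : ℚ)) * Polynomial.X ^ (n - k)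

/-- The generator `y` of the field of rational functions `ℚ(y)`. -/
noncomputable def yR : RatFunc ℚ := RatFunc.X

theorem Mform_eq_sum_range (n : ℕ) :
    Mform n = ∑ k ∈ Finset.range (n + 1),
      C ((-1 : ℚ) ^ k * (Nat.choose (n - k) k : ℚ)) * X ^ (n - k) := by
  refine Finset.sum_subset (fun k hk => ?_) (fun k _ hk => ?_)
  · simp only [Finset.mem_range] at *
    omega
  · simp only [Finset.mem_range] at hk
    rw [Nat.choose_eq_zero_of_lt (by omega)]
    simp

theorem Mform_zero : Mform 0 = 1 := by
  simp [Mform]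

theorem Mform_one : Mform 1 = X := by
  simp [Mform]

theorem Mform_add_two (n : ℕ) : Mform (n + 2) = X * Mform (n + 1) - X * Mform n := by
  rw [Mform_eq_sum_range (n + 2), Mform_eq_sum_range (n + 1), Mform_eq_sum_range n,
    Finset.sum_range_succ, Finset.sum_range_succ', Finset.sum_range_succ' _ (n + 1), mul_add,
    add_sub_right_comm, Finset.mul_sum, Finset.mul_sum, ← Finset.sum_sub_distrib]
  have hlast : Nat.choose (n + 2 - (n + 2)) (n + 2) = 0 := by simp
  rw [hlast, Nat.cast_zero, mul_zero, C_0, zero_mul, add_zero]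
  congr 1
  · refine Finset.sum_congr rfl fun k hk => ?_
    have hk' : k ≤ n := Nat.lt_succ_iff.mp (Finset.mem_range.mp hk)
    rw [show n + 2 - (k + 1) = (n - k) + 1 by omega, show n + 1 - (k + 1) = n - k by omega,
      Nat.choose_succ_succ']
    simp only [Nat.cast_add, C_mul, C_add, C_pow, C_neg, C_1]
    ring
  · simp only [pow_zero, Nat.sub_zero, Nat.choose_zero_right, Nat.cast_one, mul_one, C_1, one_mul]
    ring

/-- The polynomials `Mform n`, evaluated at `z = u + v = u v`, satisfy the Binet-type formula
of the linear recurrence with characteristic roots `u` and `v`. -/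
theorem aeval_Mform_mul_sub {A : Type*} [CommRing A] [Algebra ℚ A] {u v z : A}
    (hadd : u + v = z) (hmul : u * v = z) (n : ℕ) :
    aeval z (Mform n) * (u - v) = u ^ (n + 1) - v ^ (n + 1) := by
  induction n using Nat.twoStepInduction with
  | zero => simp [Mform_zero]
  | one =>
    rw [Mform_one, aeval_X, ← hadd]
    ring
  | more n ih₀ ih₁ =>
    rw [Mform_add_two, map_sub, map_mul, map_mul, aeval_X]
    linear_combination z * ih₁ - z * ih₀ - (u ^ (n + 2) - v ^ (n + 2)) * hadd
      + (u ^ (n + 1) - v ^ (n + 1)) * hmul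

theorem yR_ne_zero : yR ≠ 0 := RatFunc.X_ne_zero

theorem yR_sub_one_ne_zero : yR - 1 ≠ 0 := by
  have h : yR - 1 = algebraMap ℚ[X] (RatFunc ℚ) (X - C 1) := by
    simp [yR]
  rw [h]
  exact RatFunc.algebraMap_ne_zero (X_sub_C_ne_zero 1)

/-- For `m = ℳ(t)`, in `ℚ(y)` one has
`m(y²/(y−1)) · (y−2)/(y−1) = t(y) − (1/(y−1)) · t(y/(y−1))`. -/
theorem M_ratFunc_identity (M : Polynomial ℚ →ₗ[ℚ] Polynomial ℚ)
    (hM : ∀ n : ℕ, M (Polynomial.X ^ n) = Mform n)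
    (t : Polynomial ℚ) :
    Polynomial.aeval (yR ^ 2 / (yR - 1)) (M t) * ((yR - 2) / (yR - 1)) =
      Polynomial.aeval yR t - (1 / (yR - 1)) * Polynomial.aeval (yR / (yR - 1)) t := by
  have h₀ := yR_ne_zero
  have h₁ := yR_sub_one_ne_zero
  induction t using Polynomial.induction_on' with
  | add p q hp hq =>
    simp only [map_add]
    linear_combination hp + hq
  | monomial n a =>
    have hadd : yR + yR / (yR - 1) = yR ^ 2 / (yR - 1) := by
      field_simp
      ring
    have hmul : yR * (yR / (yR - 1)) = yR ^ 2 / (yR - 1) := by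
      ring
    have key := aeval_Mform_mul_sub hadd hmul n
    have hsub : yR - yR / (yR - 1) = yR * ((yR - 2) / (yR - 1)) := by
      field_simp
      ring
    have hX : aeval (yR ^ 2 / (yR - 1)) (Mform n) * ((yR - 2) / (yR - 1)) =
        yR ^ n - 1 / (yR - 1) * (yR / (yR - 1)) ^ n := by
      apply mul_left_cancel₀ h₀
      rw [hsub] at key
      linear_combination key
    have hmon : M (C a * X ^ n) = C a * Mform n := by
      rw [← smul_eq_C_mul, map_smul, hM, smul_eq_C_mul]
    rw [← C_mul_X_pow_eq_monomial, hmon]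
    simp only [map_mul, map_pow, aeval_C, aeval_X]
    linear_combination algebraMap ℚ (RatFunc ℚ) a * hX
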